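/- Let X and Y be Archimedean Riesz spaces over ℝ and T : X → Y a linear map. The following are equivalent: (1) T is order bounded: T maps order bounded subsets of X (sets contained in some order interval [−u, u]) to order bounded subsets of Y; (2) T is relatively uniformly continuous: for every net (x_α) in X and x ∈ X, x_α →u x implies T x_α →u T x; (3) T is relatively-uniformly-to-order continuous: for every net (x_α) in X and x ∈ X, x_α →u x implies T x_α →o T x. -/

import Mathlib

open Filter Set Topology

universe u v

/-- Order convergence of a net `x : A → X` to `l` in a vector lattice. -/
def OrderConv {X : Type u} {A : Type v} [Lattice X] [AddCommGroup X] [Preorder A]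
    (x : A → X) (l : X) : Prop :=
  ∃ (Γ : Type u) (pΓ : Preorder Γ), Nonempty Γ ∧ IsDirected Γ pΓ.le ∧
    ∃ d : Γ → X,
      (∀ γ₁ γ₂ : Γ, pΓ.le γ₁ γ₂ → d γ₂ ≤ d γ₁) ∧
      IsGLB (Set.range d) 0 ∧
      ∀ γ : Γ, ∃ α₀ : A, ∀ α : A, α₀ ≤ α → |x α - l| ≤ d γ

/-- Relative uniform convergence of a net `x : A → X` to `l`: there is
`e ≥ 0` such that for every `ε > 0` eventually `|x α - l| ≤ ε • e`. -/
def RUConv {X : Type u} {A : Type v} [Lattice X] [AddCommGroup X] [Module ℝ X]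
    [Preorder A] (x : A → X) (l : X) : Prop :=
  ∃ e : X, 0 ≤ e ∧ ∀ ε : ℝ, 0 < ε →
    ∃ α₀ : A, ∀ α : A, α₀ ≤ α → |x α - l| ≤ ε • e

/-- In an Archimedean Riesz space, the multiples `v / (n + 1)` of `0 ≤ v` decrease to `0`. -/
theorem isGLB_range_inv_smul {X : Type u} [Lattice X] [AddCommGroup X]
    [Module ℝ X] [PosSMulMono ℝ X] (hX : ∀ x u : X, (∀ n : ℕ, n • x ≤ u) → x ≤ 0)
    {v : X} (hv : 0 ≤ v) :
    IsGLB (Set.range fun n : ULift.{u} ℕ => ((n.down : ℝ) + 1)⁻¹ • v) 0 := by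
  refine ⟨?_, fun b hb => hX b v fun n => ?_⟩
  · rintro _ ⟨n, rfl⟩
    exact smul_nonneg (by positivity) hv
  · rcases n with _ | n
    · simpa using hv
    · have h := smul_le_smul_of_nonneg_left (hb ⟨⟨n⟩, rfl⟩) (by positivity : (0 : ℝ) ≤ n + 1)
      rw [smul_inv_smul₀ (by positivity)] at h
      rw [← Nat.cast_smul_eq_nsmul ℝ]
      exact_mod_cast h

section RieszSpace

variable {X : Type u} [Lattice X] [AddCommGroup X] [CovariantClass X X (· + ·) (· ≤ ·)]

/-- In a lattice-ordered group, `|a| ≤ b` says that `a` lies in the order interval `[-b, b]`. -/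
theorem abs_le_iff_mem_Icc_neg {a b : X} : |a| ≤ b ↔ a ∈ Set.Icc (-b) b := by
  have : AddLeftMono X := ‹_›
  rw [abs, sup_le_iff, Set.mem_Icc, neg_le, and_comm]

variable [Module ℝ X] [PosSMulMono ℝ X]

/-- Rescaling an element of an order interval of a Riesz space. -/
theorem abs_smul_le_smul_of_abs_le {a b : X} {c : ℝ} (hc : 0 ≤ c) (h : |a| ≤ b) :
    |c • a| ≤ c • b := by
  rw [abs_le_iff_mem_Icc_neg] at h ⊢
  refine ⟨?_, smul_le_smul_of_nonneg_left h.2 hc⟩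
  rw [← smul_neg]
  exact smul_le_smul_of_nonneg_left h.1 hc

/-- Nonnegative elements of a Riesz space scale monotonically. -/
theorem smul_le_smul_of_le_of_zero_le {a b : ℝ} {v : X} (hab : a ≤ b) (hv : 0 ≤ v) :
    a • v ≤ b • v := by
  have : AddLeftMono X := ‹_›
  rw [← sub_nonneg, ← sub_smul]
  exact smul_nonneg (sub_nonneg.2 hab) hv

/-- The right endpoint of a symmetric order interval containing a point is nonnegative. -/
theorem zero_le_of_abs_le {a b : X} (h : |a| ≤ b) : 0 ≤ b := by
  have : AddLeftMono X := ‹_›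
  rw [abs_le_iff_mem_Icc_neg] at h
  have h2 : 0 ≤ b + b := by
    have := h.1.trans h.2
    rwa [neg_le_iff_add_nonneg] at this
  have h3 := smul_nonneg (by norm_num : (0 : ℝ) ≤ 1 / 2) h2
  rwa [← two_smul ℝ b, smul_smul, show (1 / 2 : ℝ) * 2 = 1 by norm_num, one_smul] at h3

/-- Relative uniform convergence implies order convergence in an Archimedean Riesz space. -/
theorem RUConv.orderConv (hX : ∀ x u : X, (∀ n : ℕ, n • x ≤ u) → x ≤ 0)
    {A : Type v} [Preorder A] {x : A → X} {l : X} (h : RUConv x l) : OrderConv x l := by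
  obtain ⟨e, he, h⟩ := h
  refine ⟨ULift.{u} ℕ, inferInstance, inferInstance, inferInstance,
    fun n => ((n.down : ℝ) + 1)⁻¹ • e, fun m n hmn => ?_, isGLB_range_inv_smul hX he,
    fun n => h _ (by positivity)⟩
  have hmn' : (m.down : ℝ) ≤ n.down := Nat.cast_le.2 hmn
  exact smul_le_smul_of_le_of_zero_le (by gcongr) he

variable {Y : Type v} [Lattice Y] [AddCommGroup Y] [CovariantClass Y Y (· + ·) (· ≤ ·)]
  [Module ℝ Y] [PosSMulMono ℝ Y]

/-- An order bounded linear map preserves relative uniform convergence. -/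
theorem RUConv.map_of_orderBounded {T : X →ₗ[ℝ] Y}
    (hT : ∀ A : Set X, (∃ u : X, A ⊆ Set.Icc (-u) u) → ∃ v : Y, T '' A ⊆ Set.Icc (-v) v)
    {A : Type*} [Preorder A] {x : A → X} {l : X} (h : RUConv x l) :
    RUConv (fun α => T (x α)) (T l) := by
  obtain ⟨e, he, h⟩ := h
  obtain ⟨v, hv⟩ := hT _ ⟨e, Subset.rfl⟩
  have key : ∀ a : X, |a| ≤ e → |T a| ≤ v := fun a ha =>
    abs_le_iff_mem_Icc_neg.2 (hv ⟨a, abs_le_iff_mem_Icc_neg.1 ha, rfl⟩)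
  refine ⟨v, zero_le_of_abs_le (key 0 (by simpa using he)), fun ε hε => ?_⟩
  obtain ⟨α₀, hα₀⟩ := h ε hε
  refine ⟨α₀, fun α hα => ?_⟩
  have h1 := abs_smul_le_smul_of_abs_le (inv_nonneg.2 hε.le) (hα₀ α hα)
  rw [inv_smul_smul₀ hε.ne'] at h1
  have h2 := abs_smul_le_smul_of_abs_le hε.le (key _ h1)
  rwa [map_smul, smul_inv_smul₀ hε.ne', map_sub] at h2

/-- A linear map sending relatively uniformly convergent nets to order convergent nets is order
bounded. -/
theorem orderBounded_of_relUnif_to_order_continuous {T : X →ₗ[ℝ] Y}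
    (hT : ∀ (Λ : Type u) [Preorder Λ] [Nonempty Λ] [IsDirected Λ (· ≤ ·)]
      (x : Λ → X) (l : X), RUConv x l → OrderConv (fun α => T (x α)) (T l))
    (A : Set X) (hA : ∃ u : X, A ⊆ Set.Icc (-u) u) : ∃ v : Y, T '' A ⊆ Set.Icc (-v) v := by
  obtain ⟨u, hu⟩ := hA
  rcases A.eq_empty_or_nonempty with rfl | ⟨a₀, ha₀⟩
  · exact ⟨0, by simp⟩
  have hu0 : 0 ≤ u := zero_le_of_abs_le (abs_le_iff_mem_Icc_neg.2 (hu ha₀))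
  obtain ⟨Λ, k, y, hky⟩ : ∃ (Λ : Type u) (k : Λ → ℕ) (y : Λ → A),
      ∀ n a, ∃ p, k p = n ∧ y p = a :=
    ⟨ℕ × A, Prod.fst, Prod.snd, fun n a => ⟨(n, a), rfl, rfl⟩⟩
  let _ : Preorder Λ := Preorder.lift k
  have : Nonempty Λ := ⟨(hky 0 ⟨a₀, ha₀⟩).choose⟩
  have : IsDirected Λ (· ≤ ·) :=
    ⟨fun p q => (le_total (k p) (k q)).elim (fun h => ⟨q, h, le_refl (k q)⟩)
      fun h => ⟨p, le_refl (k p), h⟩⟩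
  have hconv : RUConv (fun p : Λ => ((k p : ℝ) + 1)⁻¹ • (y p : X)) 0 := by
    refine ⟨u, hu0, fun ε hε => ?_⟩
    obtain ⟨n, hn⟩ := exists_nat_one_div_lt hε
    obtain ⟨q, rfl, -⟩ := hky n ⟨a₀, ha₀⟩
    refine ⟨q, fun p hp => ?_⟩
    have hp' : (k q : ℝ) ≤ k p := Nat.cast_le.2 hp
    rw [sub_zero]
    refine (abs_smul_le_smul_of_abs_le (by positivity)
      (abs_le_iff_mem_Icc_neg.2 (hu (y p).2))).trans (smul_le_smul_of_le_of_zero_le ?_ hu0)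
    rw [one_div] at hn
    exact le_trans (by gcongr) hn.le
  obtain ⟨Γ, _, ⟨γ⟩, _, d, _, _, hd⟩ := hT _ _ _ hconv
  obtain ⟨q, hq⟩ := hd γ
  refine ⟨((k q : ℝ) + 1) • d γ, ?_⟩
  rintro _ ⟨a, ha, rfl⟩
  obtain ⟨p, hkp, hyp⟩ := hky (k q) ⟨a, ha⟩
  have h1 := abs_smul_le_smul_of_abs_le (by positivity : (0 : ℝ) ≤ k q + 1) (hq p hkp.ge)
  beta_reduce at h1
  rw [map_zero, sub_zero, map_smul, hkp, hyp, smul_inv_smul₀ (by positivity)] at h1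
  exact abs_le_iff_mem_Icc_neg.1 h1

end RieszSpace

/-- For a linear map `T : X → Y` between Archimedean Riesz
spaces over `ℝ`, the following are equivalent: (1) `T` is order bounded;
(2) `T` is relatively uniformly continuous; (3) `T` maps relatively uniformly
convergent nets to order convergent nets. -/
theorem orderBounded_iff_relUnif_continuous_iff_relUnif_to_order_continuous
    {X : Type u} {Y : Type v}
    [Lattice X] [AddCommGroup X] [CovariantClass X X (· + ·) (· ≤ ·)]
    [Module ℝ X] [PosSMulMono ℝ X]
    [Lattice Y] [AddCommGroup Y] [CovariantClass Y Y (· + ·) (· ≤ ·)]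
    [Module ℝ Y] [PosSMulMono ℝ Y]
    (hX : ∀ x u : X, (∀ n : ℕ, n • x ≤ u) → x ≤ 0)
    (hY : ∀ y v : Y, (∀ n : ℕ, n • y ≤ v) → y ≤ 0)
    (T : X →ₗ[ℝ] Y) :
    ((∀ A : Set X, (∃ u : X, A ⊆ Set.Icc (-u) u) →
        ∃ v : Y, T '' A ⊆ Set.Icc (-v) v) ↔
      (∀ (Λ : Type u) [Preorder Λ] [Nonempty Λ] [IsDirected Λ (· ≤ ·)]
        (x : Λ → X) (l : X), RUConv x l → RUConv (fun α => T (x α)) (T l))) ∧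
    ((∀ (Λ : Type u) [Preorder Λ] [Nonempty Λ] [IsDirected Λ (· ≤ ·)]
        (x : Λ → X) (l : X), RUConv x l → RUConv (fun α => T (x α)) (T l)) ↔
      (∀ (Λ : Type u) [Preorder Λ] [Nonempty Λ] [IsDirected Λ (· ≤ ·)]
        (x : Λ → X) (l : X), RUConv x l → OrderConv (fun α => T (x α)) (T l))) := by
  have h31 := orderBounded_of_relUnif_to_order_continuous (T := T)
  refine ⟨⟨fun h Λ _ _ _ x l hx => hx.map_of_orderBounded h, fun h => h31 ?_⟩,
    ⟨fun h Λ _ _ _ x l hx => (h Λ x l hx).orderConv hY,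
      fun h Λ _ _ _ x l hx => hx.map_of_orderBounded (h31 h)⟩⟩
  exact fun Λ _ _ _ x l hx => (h Λ x l hx).orderConv hY
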